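/- Let X be a set, f : X → X a map, and B ⊆ X a subset with f^{−1}(B) ∩ B = ∅. Let φ : X → ℝ be a function with |φ(x)| ≤ K for all x ∈ X, and define ψ : X → ℝ by ψ(x) = φ(x) if x ∈ B, ψ(x) = −φ(f(x)) if x ∈ f^{−1}(B), and ψ(x) = 0 otherwise (this is well defined since B and f^{−1}(B) are disjoint). Then the Birkhoff sums of ψ are uniformly bounded: |S_nψ(x)| ≤ 2K for every x ∈ X and every n ≥ 1. -/

import Mathlib

/-- Birkhoff sum `S_n ψ (x) = ψ(x) + ψ(f x) + ⋯ + ψ(f^[n-1] x)`. -/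
def birkhoffSum' {X : Type*} (f : X → X) (ψ : X → ℝ) (n : ℕ) (x : X) : ℝ :=
  ∑ i ∈ Finset.range n, ψ (f^[i] x)

/-- let `B ⊆ X` with `f⁻¹(B) ∩ B = ∅`, `|φ| ≤ K`, and let `ψ` equal `φ` on
`B`, `-φ ∘ f` on `f⁻¹(B)`, and `0` elsewhere. Then the Birkhoff sums of `ψ` are uniformly
bounded: `|S_nψ(x)| ≤ 2K` for every `x ∈ X` and every `n ≥ 1`. -/
theorem birkhoff_bounded_of_coboundary_potential {X : Type*} (f : X → X) (B : Set X)
    (hdisj : f ⁻¹' B ∩ B = ∅)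
    (φ : X → ℝ) (K : ℝ) (hK : ∀ x, |φ x| ≤ K)
    (ψ : X → ℝ)
    (hψB : ∀ x ∈ B, ψ x = φ x)
    (hψV : ∀ x ∈ f ⁻¹' B, ψ x = -φ (f x))
    (hψ0 : ∀ x, x ∉ B → x ∉ f ⁻¹' B → ψ x = 0) :
    ∀ x : X, ∀ n : ℕ, 1 ≤ n → |birkhoffSum' f ψ n x| ≤ 2 * K := by
  have hcob : ∀ x, ψ x = B.indicator φ x - B.indicator φ (f x) := by
    intro x
    by_cases hx : x ∈ B
    · have hfx : f x ∉ B := fun h => (Set.ext_iff.mp hdisj x).mp ⟨h, hx⟩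
      simp [hψB x hx, hx, hfx]
    · by_cases hfx : f x ∈ B
      · simp [hψV x hfx, hx, hfx]
      · simp [hψ0 x hx hfx, hx, hfx]
  have hbound : ∀ x, |B.indicator φ x| ≤ K := fun x =>
    (norm_indicator_le_norm_self φ x).trans (hK x)
  intro x n _
  have hsum : birkhoffSum' f ψ n x = B.indicator φ x - B.indicator φ (f^[n] x) := by
    simp only [birkhoffSum', hcob, ← Function.iterate_succ_apply']
    exact Finset.sum_range_sub' (fun i => B.indicator φ (f^[i] x)) n
  rw [hsum, two_mul]
  exact (abs_sub _ _).trans (add_le_add (hbound _) (hbound _))
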